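/- arXiv:2310.13880 — 4 statements merged into one kernel-verified Lean document; each statement's English description precedes it below -/
import Mathlib

section
/- Let F be a number field and K a finite extension of F (inside a fixed algebraic closure of F), and let d ≥ 2 be an integer. Then there exist infinitely many intermediate fields L of the algebraic closure over F such that L/F is a Galois extension of degree d and L is linearly disjoint from K over F. (Lemma 2.5.) -/
open IntermediateField

open Polynomial in
/-- A prime not dividing the discriminant of `K` has irreducible cyclotomic polynomial over `K`. -/
theorem NumberField.irreducible_cyclotomic_of_not_dvd_discr (K : Type*) [Field K] [NumberField K]
    {p : ℕ} (hp : p.Prime) (h : ¬ (p : ℤ) ∣ NumberField.discr K) :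
    Irreducible (cyclotomic p K) := by
  have : NeZero p := ⟨hp.ne_zero⟩
  let E := CyclotomicField p K
  have : NumberField E := IsCyclotomicExtension.numberField {p} K E
  have hζ : IsPrimitiveRoot (IsCyclotomicExtension.zeta p K E) p :=
    IsCyclotomicExtension.zeta_spec p K E
  set ζ := IsCyclotomicExtension.zeta p K E
  have hC : IsCyclotomicExtension {p} ℚ ℚ⟮ζ⟯ :=
    hζ.intermediateField_adjoin_isCyclotomicExtension ℚ
  have : IsGalois ℚ ℚ⟮ζ⟯ := IsCyclotomicExtension.isGalois {p} ℚ _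
  have hdisj : ℚ⟮ζ⟯.LinearDisjoint K := by
    suffices H : ℚ⟮ζ⟯.LinearDisjoint (IsScalarTower.toAlgHom ℚ K E).fieldRange from
      linearDisjoint_iff'.1 H
    apply NumberField.linearDisjoint_of_isGalois_isCoprime_discr
    rw [← NumberField.discr_eq_discr_of_algEquiv K
      (L := (IsScalarTower.toAlgHom ℚ K E).fieldRange)
      (AlgEquiv.ofInjectiveField (IsScalarTower.toAlgHom ℚ K E)), Int.isCoprime_iff_nat_coprime,
      IsCyclotomicExtension.Rat.natAbs_discr p]
    refine Nat.Coprime.coprime_div_left ?_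
      (Nat.prod_primeFactors_pow_totient_ediv_dvd (NeZero.pos _))
    exact Nat.Coprime.pow_left _ ((Nat.Prime.coprime_iff_not_dvd hp).2
      (by rwa [← Int.natCast_dvd]))
  have hint : IsIntegral K ζ := Algebra.IsIntegral.isIntegral ζ
  have hle : p.totient ≤ Module.finrank K E := by
    have hli := hdisj.linearIndependent_left (Module.finBasis ℚ ℚ⟮ζ⟯).linearIndependent
    rw [← IsCyclotomicExtension.finrank ℚ⟮ζ⟯ (cyclotomic.irreducible_rat (NeZero.pos p))]
    simpa using hli.fintype_card_le_finrank
  rw [(hζ.powerBasis K).finrank, IsPrimitiveRoot.powerBasis_dim] at hle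
  rw [← natDegree_cyclotomic p K] at hle
  rw [eq_of_monic_of_dvd_of_natDegree_le (minpoly.monic hint) (cyclotomic.monic p K)
    (minpoly.dvd _ _ (by
      rw [aeval_def, ← eval_map, map_cyclotomic]; exact hζ.isRoot_cyclotomic hp.pos)) hle]
  exact minpoly.irreducible hint

/-- `F⟮x⟯` is linearly disjoint from `K` if the degree of `x` does not drop over `K`. -/
theorem IntermediateField.linearDisjoint_adjoin_simple_of_natDegree_minpoly_eq
    {F E : Type*} [Field F] [Field E] [Algebra F E] (K : IntermediateField F E) {x : E}
    (hx : IsIntegral F x) (h : (minpoly K x).natDegree = (minpoly F x).natDegree) :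
    F⟮x⟯.LinearDisjoint K := by
  refine LinearDisjoint.of_basis_left (adjoin.powerBasis hx).basis ?_
  have := (linearIndependent_pow (K := K) x).comp (Fin.cast h.symm) (Fin.cast_injective _)
  convert! this with i
  simp only [PowerBasis.coe_basis, adjoin.powerBasis_gen]
  rfl

/-- A cyclic extension has a Galois subextension of every degree dividing its degree. -/
theorem IsGalois.exists_intermediateField_finrank_eq_of_isCyclic {F C : Type*} [Field F] [Field C]
    [Algebra F C] [FiniteDimensional F C] [IsGalois F C] [IsCyclic Gal(C/F)] {d : ℕ}
    (hd : d ∣ Module.finrank F C) :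
    ∃ L : IntermediateField F C, IsGalois F L ∧ Module.finrank F L = d := by
  let _ : CommGroup Gal(C/F) := IsCyclic.commGroup
  refine ⟨fixedField (powMonoidHom d : Gal(C/F) →* Gal(C/F)).range,
    IsGalois.of_fixedField_normal_subgroup _, ?_⟩
  rw [IntermediateField.finrank_eq_fixingSubgroup_index, fixingSubgroup_fixedField,
    IsCyclic.index_powMonoidHom_range, IsGalois.card_aut_eq_finrank]
  exact Nat.gcd_eq_right hd

/-- There is a Galois extension of `F` of any given degree linearly disjoint from `K`, found inside
the extension generated by a root of unity of large prime order. -/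
theorem exists_isGalois_finrank_eq_linearDisjoint
    {F : Type*} [Field F] [NumberField F]
    (K : IntermediateField F (AlgebraicClosure F)) [FiniteDimensional F K]
    {d : ℕ} (hd : d ≠ 0) :
    ∃ L : IntermediateField F (AlgebraicClosure F),
      IsGalois F L ∧ Module.finrank F L = d ∧ L.LinearDisjoint K := by
  have : NumberField K := NumberField.of_module_finite F K
  obtain ⟨p, hpgt, hp, hpd⟩ := Nat.forall_exists_prime_gt_and_modEq
    ((NumberField.discr F).natAbs + (NumberField.discr K).natAbs) hd (Nat.coprime_one_left d)
  have irr (k : Type _) [Field k] [NumberField k] (hk : (NumberField.discr k).natAbs < p) :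
      Irreducible (Polynomial.cyclotomic p k) := by
    refine NumberField.irreducible_cyclotomic_of_not_dvd_discr k hp fun h ↦ ?_
    exact hk.not_ge <| Nat.le_of_dvd (Int.natAbs_pos.2 (NumberField.discr_ne_zero k))
      (Int.natCast_dvd.1 h)
  have hF := irr F (by omega)
  have hK := irr K (by omega)
  have : NeZero p := ⟨hp.ne_zero⟩
  obtain ⟨ζ, hζ⟩ := HasEnoughRootsOfUnity.exists_primitiveRoot (AlgebraicClosure F) p
  have : IsCyclotomicExtension {p} F F⟮ζ⟯ :=
    hζ.intermediateField_adjoin_isCyclotomicExtension F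
  have : IsGalois F F⟮ζ⟯ := IsCyclotomicExtension.isGalois {p} F _
  have : FiniteDimensional F F⟮ζ⟯ := IsCyclotomicExtension.finiteDimensional {p} F _
  have hdisj : F⟮ζ⟯.LinearDisjoint K := by
    refine linearDisjoint_adjoin_simple_of_natDegree_minpoly_eq K
      (Algebra.IsIntegral.isIntegral ζ) ?_
    rw [← hζ.minpoly_eq_cyclotomic_of_irreducible hF, ← hζ.minpoly_eq_cyclotomic_of_irreducible hK,
      Polynomial.natDegree_cyclotomic, Polynomial.natDegree_cyclotomic]
  have : IsCyclic (ZMod p)ˣ := ZMod.isCyclic_units_prime hp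
  have : IsCyclic Gal(F⟮ζ⟯/F) :=
    isCyclic_of_surjective _ (IsCyclotomicExtension.autEquivPow F⟮ζ⟯ hF).symm.surjective
  obtain ⟨L, hL, hLd⟩ := IsGalois.exists_intermediateField_finrank_eq_of_isCyclic
    (F := F) (C := F⟮ζ⟯) (d := d) (by
      rw [IsCyclotomicExtension.finrank F⟮ζ⟯ hF, Nat.totient_prime hp]
      exact (Nat.modEq_iff_dvd' hp.one_le).1 hpd.symm)
  refine ⟨lift L, IsGalois.of_algEquiv (liftAlgEquiv L), ?_, hdisj.of_le_left (lift_le L)⟩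
  rw [← hLd]
  exact (liftAlgEquiv L).toLinearEquiv.finrank_eq.symm

/-- Lemma 2.5: given a finite extension `K` of a number field `F` (inside a fixed algebraic
closure of `F`) and an integer `d ≥ 2`, there are infinitely many intermediate fields `L`
of the algebraic closure over `F` that are Galois of degree `d` over `F` and linearly
disjoint from `K` over `F`. -/
theorem infinitely_many_linearly_disjoint_galois_extensions
    {F : Type*} [Field F] [NumberField F]
    (K : IntermediateField F (AlgebraicClosure F)) [FiniteDimensional F K]
    (d : ℕ) (hd : 2 ≤ d) :
    {L : IntermediateField F (AlgebraicClosure F) |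
      IsGalois F L ∧ Module.finrank F L = d ∧ L.LinearDisjoint K}.Infinite := by
  intro hfin
  set S := {L : IntermediateField F (AlgebraicClosure F) |
      IsGalois F L ∧ Module.finrank F L = d ∧ L.LinearDisjoint K}
  have : Finite S := hfin
  have (L : S) : FiniteDimensional F L.1 :=
    Module.finite_of_finrank_pos (by rw [L.2.2.1]; omega)
  obtain ⟨L, hL, hLd, hdisj⟩ :=
    exists_isGalois_finrank_eq_linearDisjoint (K ⊔ ⨆ L : S, L.1) (d := d) (by omega)
  have hLS : L ∈ S := ⟨hL, hLd, hdisj.of_le_right le_sup_left⟩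
  have hbot := (hdisj.of_le_right ((le_iSup (fun L : S ↦ L.1) ⟨L, hLS⟩).trans
    le_sup_right)).eq_bot_of_self
  rw [hbot, IntermediateField.finrank_bot] at hLd
  omega
end

section
/- Let K be a number field. For all integers n ≥ 3 and d ≥ 1, there exists an irreducible polynomial f ∈ K[x] of degree n·d whose root cluster size is d. (Theorem 1.3(a).) -/
open Polynomial IntermediateField

theorem exists_prime_gt_dvd_eval (m : ℤ[X]) (hm : m.natDegree ≠ 0) (N : ℕ) :
    ∃ q : ℕ, q.Prime ∧ N < q ∧ ∃ k : ℤ, (q : ℤ) ∣ m.eval k := by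
  have finite_fiber (c : ℤ) : {k : ℤ | m.eval k = c}.Finite := by
    have h0 : m - C c ≠ 0 := by
      intro h
      apply hm
      rw [sub_eq_zero.mp h, natDegree_C]
    refine (m - C c).roots.toFinset.finite_toSet.subset fun k hk => ?_
    have hk : m.eval k = c := hk
    simpa [hk] using h0
  obtain ⟨k₀, hk₀⟩ := (finite_fiber 0).infinite_compl.nonempty
  set c := m.eval k₀
  have hc0 : c ≠ 0 := hk₀
  have hinj : Function.Injective fun t : ℤ => k₀ + c * N.factorial * t := by
    intro s t h
    simpa [hc0, N.factorial_ne_zero] using h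
  obtain ⟨_, ⟨t, rfl⟩, ht⟩ := (Set.infinite_range_of_injective hinj).exists_notMem_finite
    ((finite_fiber c).union (finite_fiber (-c)))
  obtain ⟨s, hs⟩ : c * N.factorial * t ∣ m.eval (k₀ + c * N.factorial * t) - c := by
    simpa using sub_dvd_eval_sub (k₀ + c * N.factorial * t) k₀ m
  have hval : m.eval (k₀ + c * N.factorial * t) = c * (1 + N.factorial * t * s) := by
    linear_combination hs
  have hunit : (1 + N.factorial * t * s : ℤ).natAbs ≠ 1 := by
    intro h
    apply ht
    rcases Int.natAbs_eq_iff.mp h with h | h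
    · exact Or.inl (by simp [hval, h])
    · exact Or.inr (by simp [hval, h])
  obtain ⟨q, hq, hdvd⟩ := Nat.exists_prime_and_dvd hunit
  have hdvd : (q : ℤ) ∣ 1 + N.factorial * t * s := Int.natCast_dvd.mpr hdvd
  refine ⟨q, hq, ?_, _, hval ▸ hdvd.mul_left c⟩
  by_contra! hle
  have hqB : (q : ℤ) ∣ N.factorial * t * s :=
    ((Int.natCast_dvd_natCast.mpr (hq.dvd_factorial.mpr hle)).mul_right t).mul_right s
  have : (q : ℤ) ∣ 1 := (dvd_add_left hqB).mp hdvd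
  exact hq.one_lt.ne' (by exact_mod_cast Int.eq_one_of_dvd_one (by positivity) this)

theorem Polynomial.Separable.exists_int_bezout {m : ℤ[X]}
    (hm : (m.map (Int.castRingHom ℚ)).Separable) :
    ∃ (u v : ℤ[X]) (D : ℤ), D ≠ 0 ∧ u * m + v * derivative m = C D := by
  obtain ⟨u, v, huv⟩ := hm
  obtain ⟨a, ha, hu⟩ := IsLocalization.integerNormalization_spec (nonZeroDivisors ℤ) u
  obtain ⟨b, hb, hv⟩ := IsLocalization.integerNormalization_spec (nonZeroDivisors ℤ) v
  set U := IsLocalization.integerNormalization (nonZeroDivisors ℤ) u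
  set V := IsLocalization.integerNormalization (nonZeroDivisors ℤ) v
  refine ⟨C b * U, C a * V, a * b, mul_ne_zero (nonZeroDivisors.ne_zero ha)
    (nonZeroDivisors.ne_zero hb), map_injective (Int.castRingHom ℚ) Int.cast_injective ?_⟩
  rw [derivative_map] at huv
  simp only [algebraMap_int_eq, zsmul_eq_mul] at hu hv
  simp only [Polynomial.map_add, Polynomial.map_mul, hu, hv, Polynomial.map_C]
  simp only [eq_intCast, Int.cast_mul, C_mul, ← C_eq_intCast] at *
  linear_combination (C (a:ℚ) * C (b:ℚ)) * huv

theorem exists_prime_gt_ringHom_padic (F : Type*) [Field F] [NumberField F] (N : ℕ) :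
    ∃ (q : ℕ) (_ : Fact q.Prime), N < q ∧ Nonempty (F →+* ℚ_[q]) := by
  let pb := Field.powerBasisOfFiniteOfSeparable ℚ F
  have hint : IsIntegral ℚ pb.gen := .of_finite ℚ _
  obtain ⟨b, hb, hmap⟩ := IsLocalization.integerNormalization_spec (nonZeroDivisors ℤ)
    (minpoly ℚ pb.gen)
  set m := IsLocalization.integerNormalization (nonZeroDivisors ℤ) (minpoly ℚ pb.gen)
  have hb0 : (b : ℚ) ≠ 0 := by exact_mod_cast nonZeroDivisors.ne_zero hb
  replace hmap : m.map (Int.castRingHom ℚ) = C (b : ℚ) * minpoly ℚ pb.gen := by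
    rw [algebraMap_int_eq, zsmul_eq_mul] at hmap
    rw [hmap, ← C_eq_intCast]
  have hsep : (m.map (Int.castRingHom ℚ)).Separable := by
    rw [hmap]
    exact (Algebra.IsSeparable.isSeparable ℚ pb.gen).unit_mul (isUnit_C.mpr hb0.isUnit)
  have hdeg : m.natDegree ≠ 0 := by
    rw [← natDegree_map_eq_of_injective (f := Int.castRingHom ℚ) Int.cast_injective, hmap,
      natDegree_C_mul hb0]
    exact (minpoly.natDegree_pos hint).ne'
  obtain ⟨u, v, D, hD, hbez⟩ := hsep.exists_int_bezout
  obtain ⟨q, hq, hNq, k, hk⟩ := exists_prime_gt_dvd_eval m hdeg (N + D.natAbs)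
  have : Fact q.Prime := ⟨hq⟩
  have hqD : ¬ (q : ℤ) ∣ D := by
    intro h
    have := Nat.le_of_dvd (Int.natAbs_pos.mpr hD) (Int.natCast_dvd.mp h)
    omega
  have hqder : ¬ (q : ℤ) ∣ (derivative m).eval k := by
    intro h
    apply hqD
    have := congrArg (eval k) hbez
    simp only [eval_add, eval_mul, eval_C] at this
    exact this ▸ (hk.mul_left _).add (h.mul_left _)
  have haeval (f : ℤ[X]) : f.aeval (k : ℤ_[q]) = ((f.eval k : ℤ) : ℤ_[q]) := by
    simpa using aeval_algebraMap_apply_eq_algebraMap_eval (A := ℤ_[q]) k f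
  have hder : ‖(derivative m).aeval (k : ℤ_[q])‖ = 1 := by
    rw [haeval]
    exact le_antisymm (PadicInt.norm_le_one _)
      (not_lt.mp (mt (PadicInt.norm_int_lt_one_iff_dvd _).mp hqder))
  obtain ⟨z, hz, -⟩ := hensels_lemma (F := m) (a := (k : ℤ_[q])) (by
    rw [hder, haeval, one_pow]
    exact (PadicInt.norm_int_lt_one_iff_dvd _).mpr hk)
  have hroot : aeval (z : ℚ_[q]) (minpoly ℚ pb.gen) = 0 := by
    have h1 : aeval (z : ℚ_[q]) (m.map (Int.castRingHom ℚ)) = 0 := by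
      have := aeval_algebraMap_apply ℚ_[q] z m
      rw [hz, map_zero] at this
      rw [← algebraMap_int_eq, aeval_map_algebraMap]
      exact this
    rw [hmap, map_mul, aeval_C] at h1
    exact (mul_eq_zero.mp h1).resolve_left (by simpa using hb0)
  exact ⟨q, ⟨hq⟩, by omega, ⟨(pb.lift (z : ℚ_[q]) hroot).toRingHom⟩⟩

theorem Polynomial.IsEisensteinAt.irreducible_map_of_ringHom_padic {p : ℕ} [Fact p.Prime]
    {f : ℤ[X]} (hf : f.IsEisensteinAt (Ideal.span {(p : ℤ)})) (hmonic : f.Monic)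
    (hdeg : 0 < f.natDegree) {F : Type*} [Field F] (φ : F →+* ℚ_[p]) :
    Irreducible (f.map (Int.castRingHom F)) := by
  set g := f.map (Int.castRingHom ℤ_[p]) with hg
  have hgm : g.Monic := hmonic.map _
  have hprime : (Ideal.span {(p : ℤ_[p])}).IsPrime :=
    (Ideal.span_singleton_prime PadicInt.prime_p.ne_zero).mpr PadicInt.prime_p
  have hgE : g.IsEisensteinAt (Ideal.span {(p : ℤ_[p])}) := by
    refine hgm.isEisensteinAt_of_mem_of_notMem hprime.ne_top (fun {n} hn => ?_) ?_
    · rw [hg, coeff_map, Ideal.mem_span_singleton, eq_intCast, ← PadicInt.norm_lt_one_iff_dvd,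
        PadicInt.norm_int_lt_one_iff_dvd, ← Ideal.mem_span_singleton]
      exact hf.mem (by rwa [hg, hmonic.natDegree_map] at hn)
    · have h0 := hf.notMem
      rw [Ideal.span_singleton_pow, Ideal.mem_span_singleton] at h0 ⊢
      rwa [hg, coeff_map, eq_intCast, PadicInt.pow_p_dvd_int_iff]
  have hgi : Irreducible g := hgE.irreducible hprime hgm.isPrimitive
    (by rwa [hg, hmonic.natDegree_map])
  rw [hgm.irreducible_iff_irreducible_map_fraction_map (K := ℚ_[p])] at hgi
  refine (hmonic.map _).irreducible_of_irreducible_map φ _ ?_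
  convert hgi using 1
  rw [hg, Polynomial.map_map, Polynomial.map_map]
  congr 1
  exact RingHom.ext_int _ _

theorem irreducible_cyclotomic_of_ringHom_padic {p : ℕ} [hp : Fact p.Prime] {F : Type*} [Field F]
    (φ : F →+* ℚ_[p]) : Irreducible (cyclotomic p F) := by
  have hX : (X + 1 : ℤ[X]).natDegree = 1 := by simpa using natDegree_X_add_C (1 : ℤ)
  have h := (cyclotomic_comp_X_add_one_isEisensteinAt p).irreducible_map_of_ringHom_padic
    ((cyclotomic.monic p ℤ).comp (by simpa using monic_X_add_C (1 : ℤ)) (by simp [hX]))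
    (by simp [natDegree_comp, hX, natDegree_cyclotomic, hp.out.pos]) φ
  rw [← MulEquiv.irreducible_iff (taylorEquiv (1 : F))]
  have htaylor : taylorEquiv (1 : F) (cyclotomic p F) = (cyclotomic p F).comp (X + C 1) := rfl
  simpa [htaylor, Polynomial.map_comp] using h

theorem dvd_sub_one_of_isPrimitiveRoot_padic {p d : ℕ} [hp : Fact p.Prime] (hd : 0 < d)
    (hdp : d < p) {ζ : ℚ_[p]} (hζ : IsPrimitiveRoot ζ d) : d ∣ p - 1 := by
  have hnorm : ‖ζ‖ ≤ 1 := by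
    refine ((pow_eq_one_iff_of_nonneg (norm_nonneg ζ) hd.ne').mp ?_).le
    rw [← norm_pow, hζ.pow_eq_one, norm_one]
  let z : ℤ_[p] := ⟨ζ, hnorm⟩
  have hz : IsPrimitiveRoot z d :=
    IsPrimitiveRoot.of_map_of_injective (f := PadicInt.Coe.ringHom) hζ Subtype.coe_injective
  have hroot := (hz.isRoot_cyclotomic hd).map (f := PadicInt.toZMod)
  rw [map_cyclotomic] at hroot
  have : NeZero (d : ZMod p) := ⟨by
    rw [Ne, ZMod.natCast_eq_zero_iff]
    exact fun h => hdp.not_ge (Nat.le_of_dvd hd h)⟩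
  have hprim := isRoot_cyclotomic_iff.mp hroot
  rw [hprim.eq_orderOf]
  exact orderOf_dvd_of_pow_eq_one (ZMod.pow_card_sub_one_eq_one (hprim.ne_zero hd.ne'))

theorem IsCyclic.exists_subgroup_index_eq {G : Type*} [Group G] [Finite G] [IsCyclic G] {d : ℕ}
    (hd : d ∣ Nat.card G) : ∃ H : Subgroup G, H.index = d := by
  obtain ⟨g, hg⟩ := IsCyclic.exists_generator (α := G)
  have hd0 : 0 < d := Nat.pos_of_dvd_of_pos hd Nat.card_pos
  have hcard : Nat.card (Subgroup.zpowers (g ^ d)) = Nat.card G / d := by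
    rw [Nat.card_zpowers, orderOf_pow, orderOf_eq_card_of_forall_mem_zpowers hg,
      Nat.gcd_eq_right hd]
  refine ⟨Subgroup.zpowers (g ^ d), ?_⟩
  have h := (Subgroup.zpowers (g ^ d)).index_mul_card
  rw [hcard, ← Nat.mul_div_cancel' hd, Nat.mul_div_cancel_left _ hd0] at h
  exact Nat.eq_of_mul_eq_mul_right (Nat.div_pos (Nat.le_of_dvd Nat.card_pos hd) hd0) h

theorem exists_isGalois_finrank_eq.{u} (K : Type u) [Field K] [NumberField K] {d : ℕ} (hd : 0 < d) :
    ∃ (M : Type u) (_ : Field M) (_ : Algebra K M),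
      FiniteDimensional K M ∧ IsGalois K M ∧ Module.finrank K M = d := by
  have : NeZero d := ⟨hd.ne'⟩
  obtain ⟨p, hp, hdp, ⟨φ⟩⟩ := exists_prime_gt_ringHom_padic (CyclotomicField d K) d
  have hdvd : d ∣ p - 1 := dvd_sub_one_of_isPrimitiveRoot_padic hd hdp
    ((IsCyclotomicExtension.zeta_spec d K (CyclotomicField d K)).map_of_injective φ.injective)
  have : NeZero p := ⟨hp.out.ne_zero⟩
  have hirr : Irreducible (cyclotomic p K) :=
    irreducible_cyclotomic_of_ringHom_padic (φ.comp (algebraMap K (CyclotomicField d K)))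
  let C := CyclotomicField p K
  have : FiniteDimensional K C := IsCyclotomicExtension.finiteDimensional {p} K C
  have : IsGalois K C := IsCyclotomicExtension.isGalois {p} K C
  let e := IsCyclotomicExtension.autEquivPow C hirr
  have : IsCyclic Gal(C/K) := isCyclic_of_surjective e.symm e.symm.surjective
  have hcard : Nat.card Gal(C/K) = p - 1 := by
    rw [Nat.card_congr e.toEquiv, Nat.card_eq_fintype_card, ZMod.card_units]
  obtain ⟨H, hH⟩ := IsCyclic.exists_subgroup_index_eq (hcard ▸ hdvd)
  let _ := IsCyclic.commGroup (α := Gal(C/K))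
  have : H.Normal := inferInstance
  refine ⟨fixedField H, inferInstance, inferInstance, inferInstance, inferInstance, ?_⟩
  rw [← hH]
  have h1 := Module.finrank_mul_finrank K (fixedField H) C
  rw [finrank_fixedField_eq_card, ← IsGalois.card_aut_eq_finrank K C, ← H.index_mul_card] at h1
  exact Nat.eq_of_mul_eq_mul_right Nat.card_pos h1

/-- A trinomial that is Eisenstein at `p` and whose Newton polygon at `q` has a segment of
length one and a segment of length `n - 1` and slope `1 / (n - 1)`. -/
noncomputable def eisensteinTrinomial (n p q : ℕ) : ℤ[X] :=
  X ^ n + C (p : ℤ) * X ^ (n - 1) + C (p * q : ℤ)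

section eisensteinTrinomial

variable {n p q : ℕ}

theorem degree_eisensteinTrinomial_tail_lt (hn : 3 ≤ n) :
    (C (p : ℤ) * X ^ (n - 1) + C (p * q : ℤ)).degree < (n : WithBot ℕ) := by
  refine (degree_add_le _ _).trans_lt (max_lt ?_ ?_)
  · exact (degree_C_mul_X_pow_le _ _).trans_lt (by exact_mod_cast (by omega : n - 1 < n))
  · exact degree_C_le.trans_lt (by exact_mod_cast (by omega : 0 < n))

theorem monic_eisensteinTrinomial (hn : 3 ≤ n) : (eisensteinTrinomial n p q).Monic := by
  rw [eisensteinTrinomial, add_assoc]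
  exact monic_X_pow_add (degree_eisensteinTrinomial_tail_lt hn)

theorem natDegree_eisensteinTrinomial (hn : 3 ≤ n) : (eisensteinTrinomial n p q).natDegree = n := by
  rw [eisensteinTrinomial, add_assoc]
  refine natDegree_eq_of_degree_eq_some ?_
  rw [degree_add_eq_left_of_degree_lt, degree_X_pow]
  rw [degree_X_pow]
  exact degree_eisensteinTrinomial_tail_lt hn

theorem isEisensteinAt_eisensteinTrinomial (hn : 3 ≤ n) (hp : p.Prime) (hq : q.Prime)
    (hpq : p ≠ q) : (eisensteinTrinomial n p q).IsEisensteinAt (Ideal.span {(p : ℤ)}) := by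
  have hpZ : Prime (p : ℤ) := Nat.prime_iff_prime_int.mp hp
  refine (monic_eisensteinTrinomial hn).isEisensteinAt_of_mem_of_notMem
    ((Ideal.span_singleton_prime hpZ.ne_zero).mpr hpZ).ne_top (fun {k} hk => ?_) ?_
  · rw [natDegree_eisensteinTrinomial hn] at hk
    rw [Ideal.mem_span_singleton, eisensteinTrinomial, coeff_add, coeff_add, coeff_X_pow,
      if_neg hk.ne, zero_add, coeff_C_mul, C_mul, coeff_C_mul]
    exact (dvd_mul_right _ _).add (dvd_mul_right _ _)
  · rw [Ideal.span_singleton_pow, Ideal.mem_span_singleton, eisensteinTrinomial, coeff_add,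
      coeff_add, coeff_X_pow, if_neg (by omega), coeff_C_mul, coeff_X_pow, if_neg (by omega),
      coeff_C_zero, mul_zero, zero_add, zero_add, pow_two]
    intro h
    have h' : (p : ℤ) ∣ q := (mul_dvd_mul_iff_left hpZ.ne_zero).mp h
    exact hpq ((Nat.prime_dvd_prime_iff_eq hp hq).mp (Int.natCast_dvd_natCast.mp h'))

theorem existsUnique_root_eisensteinTrinomial_padic (hn : 3 ≤ n) (hp : p.Prime)
    [hq : Fact q.Prime] (hpq : p ≠ q) :
    ∃! x : ℚ_[q], aeval x (eisensteinTrinomial n p q) = 0 := by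
  have hqp : ¬ (q : ℤ) ∣ p := fun h =>
    hpq.symm ((Nat.prime_dvd_prime_iff_eq hq.out hp).mp (Int.natCast_dvd_natCast.mp h))
  obtain ⟨k, rfl⟩ := Nat.exists_eq_add_of_le' hn
  have hder : ‖(derivative (eisensteinTrinomial (k + 3) p q)).aeval (-p : ℤ_[q])‖ = 1 := by
    have : (derivative (eisensteinTrinomial (k + 3) p q)).aeval (-p : ℤ_[q]) =
        (-p : ℤ_[q]) ^ (k + 2) := by
      simp [eisensteinTrinomial, map_ofNat (aeval (R := ℤ) (-p : ℤ_[q]))]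
      ring
    rw [this, norm_pow, norm_neg]
    have : ‖(p : ℤ_[q])‖ = 1 := by
      rw [← Int.cast_natCast]
      exact le_antisymm (PadicInt.norm_le_one _)
        (not_lt.mp (mt (PadicInt.norm_int_lt_one_iff_dvd _).mp hqp))
    rw [this, one_pow]
  have heval (r : ℤ_[q]) : (eisensteinTrinomial (k + 3) p q).aeval r =
      r ^ (k + 2) * (r + p) + p * q := by
    simp [eisensteinTrinomial]
    ring
  obtain ⟨z, hz0, -, -, hz⟩ := hensels_lemma (F := eisensteinTrinomial (k + 3) p q)
    (a := (-p : ℤ_[q])) (by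
      rw [hder, one_pow, PadicInt.norm_lt_one_iff_dvd, heval, neg_add_cancel, mul_zero, zero_add]
      exact dvd_mul_left _ _)
  have hroot (r : ℤ_[q]) (hr : (eisensteinTrinomial (k + 3) p q).aeval r = 0) : r = z := by
    refine hz r hr ?_
    rw [hder, sub_neg_eq_add, PadicInt.norm_lt_one_iff_dvd]
    rw [heval] at hr
    have hdvd : (q : ℤ_[q]) ∣ r ^ (k + 2) * (r + p) :=
      (dvd_add_left (dvd_mul_left _ _)).mp (hr ▸ dvd_zero _)
    refine (PadicInt.prime_p.dvd_or_dvd hdvd).resolve_left fun h => hqp ?_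
    have h2 : (q : ℤ_[q]) ^ 2 ∣ r ^ (k + 2) :=
      (pow_dvd_pow_of_dvd (PadicInt.prime_p.dvd_of_dvd_pow h) 2).trans (pow_dvd_pow r (by omega))
    have h3 : (q : ℤ_[q]) ^ 2 ∣ ((p * q : ℤ) : ℤ_[q]) := by
      push_cast
      exact (dvd_add_right (h2.mul_right _)).mp (hr ▸ dvd_zero _)
    rw [PadicInt.pow_p_dvd_int_iff, pow_two] at h3
    exact (mul_dvd_mul_iff_right (by exact_mod_cast hq.out.ne_zero)).mp h3
  refine ⟨algebraMap ℤ_[q] ℚ_[q] z, ?_, fun r hr => ?_⟩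
  · simp only [aeval_algebraMap_apply, hz0, map_zero]
  · have hint : IsIntegral ℤ r := ⟨_, monic_eisensteinTrinomial hn, hr⟩
    obtain ⟨s, rfl⟩ := IsIntegrallyClosed.isIntegral_iff.mp (hint.tower_top (A := ℤ_[q]))
    simp only [aeval_algebraMap_apply, FaithfulSMul.algebraMap_eq_zero_iff] at hr
    rw [hroot s hr]

end eisensteinTrinomial

theorem AdjoinRoot.card_algHom_eq_of_subsingleton_roots {K M : Type*} [Field K] [Field M]
    [Algebra K M] [FiniteDimensional K M] [IsGalois K M] (g : ℤ[X])
    [Fact (Irreducible (g.map (Int.castRingHom M)))]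
    (hg : ∀ x y : AdjoinRoot (g.map (Int.castRingHom M)), aeval x g = 0 → aeval y g = 0 → x = y) :
    Nat.card (AdjoinRoot (g.map (Int.castRingHom M)) →ₐ[K] AdjoinRoot (g.map (Int.castRingHom M)))
      = Module.finrank K M := by
  set L := AdjoinRoot (g.map (Int.castRingHom M))
  have hroot : aeval (root (g.map (Int.castRingHom M))) g = 0 := by
    have := eval₂_root (g.map (Int.castRingHom M))
    rwa [eval₂_map, RingHom.ext_int ((of _).comp _) (algebraMap ℤ L)] at this
  rw [← IsGalois.card_aut_eq_finrank, ← Nat.card_congr (Normal.algHomEquivAut K L M)]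
  refine Nat.card_congr (Equiv.ofBijective (fun φ => φ.comp (ofAlgHom K _)) ⟨?_, ?_⟩)
  · intro φ ψ h
    refine algHom_ext' h (hg _ _ ?_ ?_)
    · simpa [hroot] using aeval_algHom_apply (φ.restrictScalars ℤ) (root _) g
    · simpa [hroot] using aeval_algHom_apply (ψ.restrictScalars ℤ) (root _) g
  · intro τ
    refine ⟨liftAlgHom _ τ (root _) ?_, ?_⟩
    · rw [eval₂_map, RingHom.ext_int (RingHom.comp _ _) (algebraMap ℤ L)]
      exact hroot
    · ext x
      simp

theorem exists_irreducible_ncard_roots_adjoin_eq {K L : Type*} [Field K] [Field L] [Algebra K L]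
    [FiniteDimensional K L] [Algebra.IsSeparable K L] :
    ∃ f : K[X], Irreducible f ∧ f.natDegree = Module.finrank K L ∧
      ∀ α : AlgebraicClosure K, aeval α f = 0 →
        {x : AlgebraicClosure K | aeval x f = 0 ∧ x ∈ K⟮α⟯}.ncard = Nat.card (L →ₐ[K] L) := by
  let pb := Field.powerBasisOfFiniteOfSeparable K L
  have hint : IsIntegral K pb.gen := .of_finite K _
  refine ⟨minpoly K pb.gen, minpoly.irreducible hint, by rw [pb.natDegree_minpoly, pb.finrank],
    fun α hα => ?_⟩
  have hmin : minpoly K α = minpoly K pb.gen :=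
    (minpoly.eq_of_irreducible_of_monic (minpoly.irreducible hint) hα (minpoly.monic hint)).symm
  have hαint : IsIntegral K α := ⟨_, minpoly.monic hint, hα⟩
  let e : K⟮α⟯ ≃ₐ[K] L := (adjoin.powerBasis hαint).equivOfMinpoly pb (by
    rw [adjoin.powerBasis_gen, minpoly_gen, hmin])
  rw [← Nat.card_congr (e.arrowCongr e), Nat.card_congr (algHomAdjoinIntegralEquiv K hαint),
    ← Nat.card_coe_set_eq, ← hmin]
  have hmem (x : K⟮α⟯) :
      x ∈ (minpoly K α).aroots K⟮α⟯ ↔ aeval (x : AlgebraicClosure K) (minpoly K α) = 0 := by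
    rw [mem_aroots, and_iff_right (minpoly.ne_zero hαint), aeval_coe]
    simp
  exact Nat.card_congr
    { toFun x := ⟨⟨x, x.2.2⟩, (hmem _).mpr x.2.1⟩
      invFun x := ⟨x, (hmem _).mp x.2, x.1.2⟩ }

/-- Theorem 1.3(a): for a number field `K` and integers `n ≥ 3`, `d ≥ 1`, there exists an
irreducible polynomial `f ∈ K[x]` of degree `n·d` whose root cluster size is `d`. -/
theorem exists_irreducible_of_degree_nd_cluster_size_d
    {K : Type*} [Field K] [NumberField K]
    (n d : ℕ) (hn : 3 ≤ n) (hd : 1 ≤ d) :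
    ∃ f : K[X], Irreducible f ∧ f.natDegree = n * d ∧
      ∀ α : AlgebraicClosure K, aeval α f = 0 →
        {x : AlgebraicClosure K | aeval x f = 0 ∧ x ∈ K⟮α⟯}.ncard = d := by
  obtain ⟨M, _, _, _, _, hM⟩ := exists_isGalois_finrank_eq K hd
  have : NumberField M := .of_module_finite K M
  obtain ⟨q, hq, -, ⟨ψ⟩⟩ := exists_prime_gt_ringHom_padic M 0
  obtain ⟨p, hp, hqp, ⟨φ⟩⟩ := exists_prime_gt_ringHom_padic M q
  set g := eisensteinTrinomial n p q
  have hdeg : g.natDegree = n := natDegree_eisensteinTrinomial hn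
  have hirr : Irreducible (g.map (Int.castRingHom M)) :=
    (isEisensteinAt_eisensteinTrinomial hn hp.out hq.out hqp.ne').irreducible_map_of_ringHom_padic
      (monic_eisensteinTrinomial hn) (by rw [hdeg]; omega) φ
  have : Fact (Irreducible (g.map (Int.castRingHom M))) := ⟨hirr⟩
  let L := AdjoinRoot (g.map (Int.castRingHom M))
  let pb := AdjoinRoot.powerBasis hirr.ne_zero
  have : FiniteDimensional M L := pb.finite
  have : FiniteDimensional K L := .trans K M L
  have hfin : Module.finrank K L = n * d := by
    rw [← Module.finrank_mul_finrank K M L, hM, pb.finrank, AdjoinRoot.powerBasis_dim,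
      (monic_eisensteinTrinomial hn).natDegree_map, hdeg, mul_comm]
  obtain ⟨z, hz, huniq⟩ := existsUnique_root_eisensteinTrinomial_padic hn hp.out hqp.ne'
  let χ : L →+* ℚ_[q] := AdjoinRoot.lift ψ z (by
    rw [eval₂_map, RingHom.ext_int (ψ.comp _) (algebraMap ℤ ℚ_[q])]
    exact hz)
  have hχ (x : L) (hx : aeval x g = 0) : χ x = z :=
    huniq _ (by simpa [hx] using aeval_algHom_apply χ.toIntAlgHom x g)
  have hcard := AdjoinRoot.card_algHom_eq_of_subsingleton_roots (K := K) g
    fun x y hx hy => χ.injective ((hχ x hx).trans (hχ y hy).symm)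
  rw [← hfin, ← hM, ← hcard]
  exact exists_irreducible_ncard_roots_adjoin_eq
end

section
/- For every even integer d ≥ 2 there exists an irreducible polynomial f ∈ ℚ[x] of degree 2d whose root cluster size is d. (Theorem 1.3(b).) -/
open Polynomial IntermediateField

/-- The minimal polynomial of a primitive element of a number field `K` has degree `[K : ℚ]` and
root cluster size `|Aut(K/ℚ)|`. -/
theorem exists_irreducible_cluster_size_eq_card_gal (K : Type*) [Field K] [Algebra ℚ K]
    [FiniteDimensional ℚ K] :
    ∃ f : ℚ[X], Irreducible f ∧ f.natDegree = Module.finrank ℚ K ∧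
      ∀ α : AlgebraicClosure ℚ, aeval α f = 0 →
        {x : AlgebraicClosure ℚ | aeval x f = 0 ∧ x ∈ ℚ⟮α⟯}.ncard = Nat.card Gal(K/ℚ) := by
  let pb := Field.powerBasisOfFiniteOfSeparable ℚ K
  refine ⟨minpoly ℚ pb.gen, minpoly.irreducible pb.isIntegral_gen, ?_, fun β hβ => ?_⟩
  · rw [pb.natDegree_minpoly, pb.finrank]
  let j : K →ₐ[ℚ] AlgebraicClosure ℚ := pb.lift β hβ
  have hj : j pb.gen = β := pb.lift_gen β hβ
  have hrange : j.fieldRange = ℚ⟮β⟯ := by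
    have htop : ℚ⟮pb.gen⟯ = ⊤ := IntermediateField.adjoin_eq_top_of_algebra _ _ pb.adjoin_gen_eq_top
    rw [AlgHom.fieldRange_eq_map, ← htop, IntermediateField.adjoin_map, Set.image_singleton, hj]
  have himage : {x : AlgebraicClosure ℚ | aeval x (minpoly ℚ pb.gen) = 0 ∧ x ∈ ℚ⟮β⟯} =
      j '' {y : K | aeval y (minpoly ℚ pb.gen) = 0} := by
    ext x
    rw [← hrange]
    constructor
    · rintro ⟨hx, y, rfl⟩
      refine ⟨y, ?_, rfl⟩
      have hy : j (aeval y (minpoly ℚ pb.gen)) = 0 := by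
        rw [← Polynomial.aeval_algHom_apply]
        exact hx
      exact (map_eq_zero j).mp hy
    · rintro ⟨y, hy, rfl⟩
      refine ⟨?_, y, rfl⟩
      rw [Polynomial.aeval_algHom_apply, hy, map_zero]
  have hinj : Function.Injective j := RingHom.injective _
  rw [himage, Set.ncard_image_of_injective _ hinj, ← Nat.card_coe_set_eq]
  exact Nat.card_congr (pb.liftEquiv.symm.trans (algEquivEquivAlgHom ℚ K).toEquiv.symm)

theorem finrank_adjoin_simple_eq_two {F E : Type*} [Field F] [Field E] [Algebra F E] {x : E} {a : F}
    (hx : x ^ 2 = algebraMap F E a) (hxF : x ∉ (algebraMap F E).range) :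
    Module.finrank F F⟮x⟯ = 2 := by
  have hroot : aeval x (X ^ 2 - C a) = 0 := by simp [hx]
  have hmonic : (X ^ 2 - C a).Monic := monic_X_pow_sub_C a two_ne_zero
  have hint : IsIntegral F x := ⟨_, hmonic, hroot⟩
  rw [IntermediateField.adjoin.finrank hint]
  refine le_antisymm ?_ ((minpoly.two_le_natDegree_iff hint).mpr hxF)
  exact (natDegree_le_of_dvd (minpoly.dvd F x hroot) hmonic.ne_zero).trans_eq
    (natDegree_X_pow_sub_C)

theorem IsCyclic.exists_subgroup_card_eq {G : Type*} [Group G] [IsCyclic G] [Finite G] {m : ℕ}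
    (hm : m ∣ Nat.card G) :
    ∃ H : Subgroup G, H.Normal ∧ Nat.card H = m ∧ ∀ g : G, g ^ m = 1 → g ∈ H := by
  let _ : CommGroup G := IsCyclic.commGroup
  refine ⟨(powMonoidHom m : G →* G).ker, inferInstance, ?_, fun g hg => hg⟩
  rw [IsCyclic.card_powMonoidHom_ker, Nat.gcd_eq_right hm]

/-- In characteristic zero, even-degree cyclic extensions contain a quadratic subextension. -/
theorem exists_sq_eq_algebraMap_of_isCyclic (K L : Type*) [Field K] [Field L] [Algebra K L]
    [CharZero K] [FiniteDimensional K L] [IsGalois K L] [IsCyclic Gal(L/K)]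
    (h : Even (Module.finrank K L)) :
    ∃ (e : L) (a : K), e ^ 2 = algebraMap K L a ∧ e ∉ (algebraMap K L).range := by
  obtain ⟨k, hk⟩ := even_iff_two_dvd.mp h
  have hcard : Nat.card Gal(L/K) = 2 * k := by rw [IsGalois.card_aut_eq_finrank, hk]
  obtain ⟨H, -, hH, -⟩ := IsCyclic.exists_subgroup_card_eq (G := Gal(L/K)) (m := k)
    (hcard ▸ dvd_mul_left k 2)
  have hpos : 0 < Module.finrank K L := Module.finrank_pos
  have hE : Module.finrank K (fixedField H) = 2 := by
    have h1 := Module.finrank_mul_finrank K (fixedField H) L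
    rw [IntermediateField.finrank_fixedField_eq_card, hH, hk] at h1
    exact Nat.eq_of_mul_eq_mul_right (by omega) h1
  have : Algebra.IsQuadraticExtension K (fixedField H) := { finrank_eq_two' := hE }
  obtain ⟨e, ⟨a, ha⟩, he⟩ := exists_root_adjoin_eq_top_of_isCyclic K (fixedField H)
    ⟨-1, by
      rw [hE, mem_primitiveRoots two_pos]
      exact IsPrimitiveRoot.neg_one 0 (by norm_num)⟩
  rw [hE] at ha
  refine ⟨e, a, ?_, ?_⟩
  · exact (congrArg (algebraMap (fixedField H) L) ha).symm
  · rintro ⟨b, hb⟩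
    have hbe : algebraMap K (fixedField H) b = e := Subtype.ext hb
    have hbot : K⟮e⟯ = ⊥ := IntermediateField.adjoin_simple_eq_bot_iff.mpr
      (IntermediateField.mem_bot.mpr ⟨b, hbe⟩)
    have h1 : Module.finrank K K⟮e⟯ = 2 := by rw [he, IntermediateField.finrank_top', hE]
    rw [hbot, IntermediateField.finrank_bot] at h1
    omega

/-- A real number field containing `s` with `s ^ 4` rational and `s ^ 2` irrational is not Galois,
since `s` has a conjugate that is not real. -/
theorem not_isGalois_of_pow_four_mem {N : IntermediateField ℚ ℝ} [FiniteDimensional ℚ N] {s : ℝ}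
    (hs : s ∈ N) {q : ℚ} (hq : s ^ 4 = q) (hirr : s ^ 2 ∉ (algebraMap ℚ ℝ).range) :
    ¬ IsGalois ℚ N := by
  intro _
  let t : N := ⟨s, hs⟩
  have ht : t ^ 4 = algebraMap ℚ N q := Subtype.ext hq
  obtain ⟨σ, hσ⟩ : ∃ σ : Gal(N/ℚ), σ (t ^ 2) ≠ t ^ 2 := by
    by_contra! hfix
    obtain ⟨b, hb⟩ := (IsGalois.mem_range_algebraMap_iff_fixed (t ^ 2)).mpr hfix
    exact hirr ⟨b, congrArg (algebraMap N ℝ) hb⟩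
  have hneg : (σ t) ^ 2 = - t ^ 2 := by
    have h4 : (σ t) ^ 4 = t ^ 4 := by rw [← map_pow, ht, AlgEquiv.commutes]
    rw [map_pow] at hσ
    have : ((σ t) ^ 2 - t ^ 2) * ((σ t) ^ 2 + t ^ 2) = 0 := by linear_combination h4
    rcases mul_eq_zero.mp this with h | h
    · exact absurd (sub_eq_zero.mp h) hσ
    · exact eq_neg_of_add_eq_zero_left h
  have hreal : ((σ t : N) : ℝ) ^ 2 = - s ^ 2 := congrArg (algebraMap N ℝ) hneg
  refine hirr ⟨0, ?_⟩
  rw [map_zero]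
  nlinarith [sq_nonneg ((σ t : N) : ℝ), sq_nonneg s]

theorem card_gal_dvd_finrank (K L : Type*) [Field K] [Field L] [Algebra K L]
    [FiniteDimensional K L] : Nat.card Gal(L/K) ∣ Module.finrank K L := by
  rw [← Subgroup.card_top, ← IntermediateField.finrank_fixedField_eq_card,
    ← Module.finrank_mul_finrank K (fixedField (⊤ : Subgroup Gal(L/K))) L]
  exact dvd_mul_left _ _

/-- Complex conjugation acts trivially on subfields of even index in a cyclic number field, so
these embed in `ℝ`. -/
theorem exists_real_cyclic_of_finrank_eq_mul (F : Type*) [Field F] [CharZero F]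
    [FiniteDimensional ℚ F] [IsGalois ℚ F] [IsCyclic Gal(F/ℚ)] {d m : ℕ}
    (hF : Module.finrank ℚ F = d * (2 * m)) :
    ∃ N : IntermediateField ℚ ℝ, FiniteDimensional ℚ N ∧ IsGalois ℚ N ∧ IsCyclic Gal(N/ℚ) ∧
      Module.finrank ℚ N = d := by
  have hcard : Nat.card Gal(F/ℚ) = d * (2 * m) := by rw [IsGalois.card_aut_eq_finrank, hF]
  obtain ⟨H, hnormal, hH, hHmem⟩ := IsCyclic.exists_subgroup_card_eq (G := Gal(F/ℚ)) (m := 2 * m)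
    (hcard ▸ dvd_mul_left _ _)
  have : IsGalois ℚ (fixedField H) := by
    convert IsGalois.of_fixedField_normal_subgroup H
    exact Subsingleton.elim _ _
  let φ : F →ₐ[ℚ] ℂ := IsAlgClosed.lift
  let _ : Algebra F ℂ := φ.toRingHom.toAlgebra
  have : IsScalarTower ℚ F ℂ := IsScalarTower.of_algebraMap_eq' φ.comp_algebraMap.symm
  let conj : ℂ ≃ₐ[ℚ] ℂ := Complex.conjAe.restrictScalars ℚ
  let c : Gal(F/ℚ) := conj.restrictNormal F
  have hc (x : F) : φ (c x) = starRingEnd ℂ (φ x) := conj.restrictNormal_commutes F x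
  have hcH : c ∈ H := by
    refine hHmem c ?_
    have hc2 : c ^ 2 = 1 := by
      ext x
      refine RingHom.injective (φ : F →+* ℂ) (show φ ((c ^ 2) x) = φ x from ?_)
      rw [pow_two, AlgEquiv.mul_apply, hc, hc, Complex.conj_conj]
    rw [pow_mul, hc2, one_pow]
  let r : ℝ →ₐ[ℚ] ℂ := Complex.ofRealAm.restrictScalars ℚ
  have hmem (x : fixedField H) : φ x ∈ r.range := by
    have hx : c x = x := (IntermediateField.mem_fixedField_iff H _).mp x.2 c hcH
    obtain ⟨y, hy⟩ := Complex.conj_eq_iff_real.mp (by rw [← hc, hx] : starRingEnd ℂ (φ x) = φ x)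
    exact ⟨y, hy.symm⟩
  let ι : fixedField H →ₐ[ℚ] ℝ := (AlgEquiv.ofInjective r r.injective).symm.toAlgHom.comp
    ((φ.comp (fixedField H).val).codRestrict r.range hmem)
  let ε : fixedField H ≃ₐ[ℚ] ι.fieldRange := AlgEquiv.ofInjectiveField ι
  have : IsCyclic Gal(fixedField H/ℚ) :=
    isCyclic_of_surjective (AlgEquiv.restrictNormalHom (fixedField H))
      (AlgEquiv.restrictNormalHom_surjective F)
  refine ⟨ι.fieldRange, ε.toLinearEquiv.finiteDimensional, IsGalois.of_algEquiv ε,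
    isCyclic_of_surjective ε.autCongr ε.autCongr.surjective, ?_⟩
  rw [← ε.toLinearEquiv.finrank_eq]
  have h1 := Module.finrank_mul_finrank ℚ (fixedField H) F
  rw [IntermediateField.finrank_fixedField_eq_card, hH, hF] at h1
  have hpos : 0 < Nat.card H := Nat.card_pos
  exact Nat.eq_of_mul_eq_mul_right (hH ▸ hpos) h1

/-- Every positive integer occurs as the degree of a real cyclic number field. -/
theorem exists_real_cyclic_of_pos {d : ℕ} (hd : 0 < d) :
    ∃ N : IntermediateField ℚ ℝ, FiniteDimensional ℚ N ∧ IsGalois ℚ N ∧ IsCyclic Gal(N/ℚ) ∧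
      Module.finrank ℚ N = d := by
  obtain ⟨p, hp, -, hmod⟩ := Nat.exists_prime_gt_modEq_one (k := 2 * d) 1 (by omega)
  have : Fact p.Prime := ⟨hp⟩
  obtain ⟨m, hm⟩ : 2 * d ∣ p - 1 := (Nat.modEq_iff_dvd' hp.one_le).mp hmod.symm
  have : NeZero (p : ℚ) := ⟨Nat.cast_ne_zero.mpr hp.ne_zero⟩
  have : IsCyclotomicExtension {p} ℚ (CyclotomicField p ℚ) := by
    convert CyclotomicField.isCyclotomicExtension p ℚ
    · rfl
    · exact Subsingleton.elim _ _
  have : IsGalois ℚ (CyclotomicField p ℚ) := IsCyclotomicExtension.isGalois {p} ℚ _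
  have : FiniteDimensional ℚ (CyclotomicField p ℚ) :=
    IsCyclotomicExtension.finiteDimensional {p} ℚ _
  let ψ := IsCyclotomicExtension.Rat.galEquivZMod p (CyclotomicField p ℚ)
  have : IsCyclic Gal(CyclotomicField p ℚ/ℚ) := isCyclic_of_surjective ψ.symm ψ.symm.surjective
  refine exists_real_cyclic_of_finrank_eq_mul (CyclotomicField p ℚ) (m := m) ?_
  rw [← IsGalois.card_aut_eq_finrank, Nat.card_congr ψ.toEquiv, Nat.card_eq_fintype_card,
    ZMod.card_units, hm]
  ring

/-- Adjoining the square root of a positive generator of the quadratic subfield of a real cyclic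
field of degree `d` gives a field of degree `2 * d` with exactly `d` automorphisms. -/
theorem exists_finrank_eq_two_mul_card_gal_eq {d : ℕ} (hd : 0 < d) (heven : Even d) :
    ∃ K : IntermediateField ℚ ℝ, FiniteDimensional ℚ K ∧ Module.finrank ℚ K = 2 * d ∧
      Nat.card Gal(K/ℚ) = d := by
  obtain ⟨N, _, _, _, hN⟩ := exists_real_cyclic_of_pos hd
  obtain ⟨e₀, q, heq₀, he₀⟩ := exists_sq_eq_algebraMap_of_isCyclic ℚ N (hN ▸ heven)
  obtain ⟨e, heN, heq, hirr, hnonneg⟩ : ∃ e : ℝ, e ∈ N ∧ e ^ 2 = algebraMap ℚ ℝ q ∧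
      e ∉ (algebraMap ℚ ℝ).range ∧ 0 ≤ e := by
    have hsq : (e₀ : ℝ) ^ 2 = algebraMap ℚ ℝ q := congrArg (algebraMap N ℝ) heq₀
    have hirr₀ : (e₀ : ℝ) ∉ (algebraMap ℚ ℝ).range := by
      rintro ⟨b, hb⟩
      exact he₀ ⟨b, Subtype.ext hb⟩
    rcases le_total 0 (e₀ : ℝ) with h | h
    · exact ⟨e₀, e₀.2, hsq, hirr₀, h⟩
    · exact ⟨-e₀, neg_mem e₀.2, by rw [neg_sq, hsq], by rwa [neg_mem_iff], neg_nonneg.mpr h⟩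
  let s := √e
  have hs2 : s ^ 2 = e := Real.sq_sqrt hnonneg
  have hs4 : s ^ 4 = (q : ℝ) := by
    rw [show s ^ 4 = (s ^ 2) ^ 2 by ring, hs2, heq, eq_ratCast]
  have hsirr : s ^ 2 ∉ (algebraMap ℚ ℝ).range := hs2 ▸ hirr
  have hsN : s ∉ N := fun h => not_isGalois_of_pow_four_mem h hs4 hsirr ‹_›
  let E := ℚ⟮e⟯
  have hEN : E ≤ N := IntermediateField.adjoin_simple_le_iff.mpr heN
  have hE : Module.finrank ℚ E = 2 := finrank_adjoin_simple_eq_two heq hirr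
  have : FiniteDimensional ℚ E := Module.finite_of_finrank_pos (by omega)
  let N' : IntermediateField E ℝ := IntermediateField.extendScalars hEN
  have : IsGalois ℚ N' := ‹IsGalois ℚ N›
  have : FiniteDimensional ℚ N' := ‹FiniteDimensional ℚ N›
  have : IsGalois E N' := IsGalois.tower_top_of_isGalois ℚ E N'
  have : FiniteDimensional E N' := Module.Finite.of_restrictScalars_finite ℚ E N'
  have hN' : 2 * Module.finrank E N' = d := by
    rw [← hE, ← hN]
    exact Module.finrank_mul_finrank ℚ E N'
  have hL : Module.finrank E E⟮s⟯ = 2 := by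
    refine finrank_adjoin_simple_eq_two (a := ⟨e, IntermediateField.mem_adjoin_simple_self ℚ e⟩)
      hs2 ?_
    rintro ⟨b, hb⟩
    exact hsN (hEN (hb ▸ b.2))
  have : Algebra.IsQuadraticExtension E E⟮s⟯ := { finrank_eq_two' := hL }
  have : FiniteDimensional E E⟮s⟯ := Module.finite_of_finrank_pos (by omega)
  let M : IntermediateField E ℝ := N' ⊔ E⟮s⟯
  have hsM : s ∈ M := (le_sup_right : E⟮s⟯ ≤ M) (IntermediateField.mem_adjoin_simple_self E s)
  have hM : Module.finrank E M = d := by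
    have hle : Module.finrank E M ≤ Module.finrank E N' * Module.finrank E E⟮s⟯ :=
      IntermediateField.finrank_sup_le _ _
    obtain ⟨k, hk⟩ := IntermediateField.finrank_dvd_of_le_right (le_sup_left : N' ≤ M)
    have hne : Module.finrank E N' ≠ Module.finrank E M := by
      intro h
      have : N' = M := IntermediateField.eq_of_le_of_finrank_eq le_sup_left h
      exact hsN (show s ∈ N' from this ▸ hsM)
    have hpos : 0 < Module.finrank E M := Module.finrank_pos
    rw [hk] at hle hne hpos ⊢
    rw [hL] at hle
    have hk2 : k ≤ 2 := Nat.le_of_mul_le_mul_left hle (by omega)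
    interval_cases k <;> omega
  have hdvd : d ∣ Nat.card Gal(M/ℚ) := by
    rw [← hM, ← IsGalois.card_aut_eq_finrank E M]
    exact Subgroup.card_dvd_of_injective (AlgEquiv.restrictScalarsHom ℚ)
      (AlgEquiv.restrictScalars_injective ℚ)
  have : FiniteDimensional ℚ M := Module.Finite.trans E M
  have : Module.Free E M := Module.Free.of_divisionRing E M
  have hfin : Module.finrank ℚ M = 2 * d := by rw [← Module.finrank_mul_finrank ℚ E M, hE, hM]
  let K : IntermediateField ℚ ℝ := M.restrictScalars ℚ
  have : FiniteDimensional ℚ K := ‹FiniteDimensional ℚ M›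
  refine ⟨K, this, hfin, ?_⟩
  have hcard : Nat.card Gal(K/ℚ) ∣ 2 * d := hfin ▸ card_gal_dvd_finrank ℚ K
  have hne : Nat.card Gal(K/ℚ) ≠ 2 * d := fun h =>
    not_isGalois_of_pow_four_mem (N := K) hsM hs4 hsirr
      (IsGalois.of_card_aut_eq_finrank ℚ K (h.trans hfin.symm))
  obtain ⟨k, hk⟩ : d ∣ Nat.card Gal(K/ℚ) := hdvd
  rw [hk] at hcard hne ⊢
  have hk2 : k ∣ 2 := Nat.dvd_of_mul_dvd_mul_left hd (by rwa [mul_comm 2 d] at hcard)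
  rcases (Nat.dvd_prime Nat.prime_two).mp hk2 with rfl | rfl
  · exact mul_one d
  · exact absurd (mul_comm d 2) hne

/-- Theorem 1.3(b): for every even integer `d ≥ 2` there exists an irreducible polynomial
`f ∈ ℚ[x]` of degree `2d` whose root cluster size is `d`. -/
theorem exists_irreducible_rat_of_degree_2d_cluster_size_d
    (d : ℕ) (hd : 2 ≤ d) (heven : Even d) :
    ∃ f : ℚ[X], Irreducible f ∧ f.natDegree = 2 * d ∧
      ∀ α : AlgebraicClosure ℚ, aeval α f = 0 →
        {x : AlgebraicClosure ℚ | aeval x f = 0 ∧ x ∈ ℚ⟮α⟯}.ncard = d := by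
  obtain ⟨K, _, hK, hcard⟩ := exists_finrank_eq_two_mul_card_gal_eq (by omega) heven
  obtain ⟨f, hf, hdeg, hroots⟩ := exists_irreducible_cluster_size_eq_card_gal K
  exact ⟨f, hf, hdeg.trans hK, fun α hα => (hroots α hα).trans hcard⟩
end

section
/- Let K be a number field. For every integer n ≥ 3 there exists an irreducible polynomial f ∈ K[x] of degree n whose root cluster size is 1, i.e., for every root α of f, the only roots of f lying in K(α) are α itself. (Proposition 3.1.) -/
open Polynomial IntermediateField

open scoped NumberField

/-- Over a finite ring, some polynomial `X ^ (m + 1) - X ^ m - c` has no root. -/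
theorem exists_forall_pow_succ_sub_pow_ne {k : Type*} [CommRing k] [Nontrivial k] [Finite k] {m : ℕ}
    (hm : m ≠ 0) : ∃ c : k, ∀ x, x ^ (m + 1) - x ^ m ≠ c := by
  by_contra! h
  have := Finite.injective_iff_surjective.2 (show Function.Surjective
    fun x : k ↦ x ^ (m + 1) - x ^ m from h)
  exact zero_ne_one (this (by simp [hm]) : (0 : k) = 1)

namespace AlgHom.IsArithFrobAt

variable {R S : Type*} [CommRing R] [CommRing S] [Algebra R S] {φ : S →ₐ[R] S} {Q : Ideal S}

/-- An element fixed by a Frobenius is congruent to an element of the base ring. -/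
theorem exists_sub_algebraMap_mem [Q.IsPrime] (H : φ.IsArithFrobAt Q) {x : S} (hx : φ x = x) :
    ∃ a : R, x - algebraMap R S a ∈ Q := by
  have := H.finite_quotient
  let := Fintype.ofFinite (R ⧸ Q.under R)
  let : Field (R ⧸ Q.under R) := (Finite.isField_of_domain (R ⧸ Q.under R)).toField
  have hroot : ((X ^ Fintype.card (R ⧸ Q.under R) - X : (R ⧸ Q.under R)[X]).map
      (algebraMap (R ⧸ Q.under R) (S ⧸ Q))).IsRoot (Ideal.Quotient.mk Q x) := by
    have := H.mk_apply x
    rw [hx, Nat.card_eq_fintype_card] at this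
    simp [← this]
  have hs := (FiniteField.isSplittingField_sub (R ⧸ Q.under R) (R ⧸ Q.under R)).splits
  rw [Algebra.algebraMap_self, Polynomial.map_id] at hs
  obtain ⟨b, hb⟩ := hs.mem_range_of_isRoot
    (FiniteField.X_pow_card_sub_X_ne_zero _ Fintype.one_lt_card) hroot
  obtain ⟨a, rfl⟩ := Ideal.Quotient.mk_surjective b
  exact ⟨a, Ideal.Quotient.eq.1 hb.symm⟩

end AlgHom.IsArithFrobAt

/-- Modulo a prime not containing the linear coefficient, `0` is at most a simple root. -/
theorem Polynomial.eq_of_isRoot_of_mem {S : Type*} [CommRing S] [IsDomain S] {Q : Ideal S}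
    {f : S[X]} (hf : f.coeff 1 ∉ Q) {x y : S} (hx : f.IsRoot x) (hy : f.IsRoot y) (hxQ : x ∈ Q)
    (hyQ : y ∈ Q) : x = y := by
  by_contra hxy
  obtain ⟨g, rfl⟩ := dvd_iff_isRoot.2 hx
  have hg : g.eval y = 0 := by
    simpa [IsRoot, sub_eq_zero, Ne.symm hxy] using hy
  have h0 : g.eval 0 ∈ Q := by
    have := Q.mem_of_dvd (sub_dvd_eval_sub 0 y g) (by simpa using hyQ)
    simpa [hg] using this
  apply hf
  rw [sub_mul, coeff_sub, coeff_X_mul, coeff_C_mul, coeff_zero_eq_eval_zero]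
  exact Q.sub_mem h0 (Q.mul_mem_right _ hxQ)

/-- If `f` splits in `S` and `0` is the unique root of `f` modulo `Q.under R` and is simple, then a
Frobenius at `Q` fixes exactly one root of `f`. -/
theorem exists_root_forall_fixed_root_eq {R S : Type*} [CommRing R] [CommRing S] [IsDomain S]
    [Algebra R S] {φ : S →ₐ[R] S} {Q : Ideal S} [Q.IsPrime] (H : φ.IsArithFrobAt Q) {f : R[X]}
    (hf : f.Monic) (hs : (f.map (algebraMap R S)).Splits) (h0 : f.coeff 0 ∈ Q.under R)
    (h1 : f.coeff 1 ∉ Q.under R) (hroot : ∀ a, f.eval a ∈ Q.under R → a ∈ Q.under R) :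
    ∃ α : S, aeval α f = 0 ∧ φ α = α ∧ ∀ β, aeval β f = 0 → φ β = β → β = α := by
  have uniq {x y : S} (hx : aeval x f = 0) (hy : aeval y f = 0) (hxQ : x ∈ Q) (hyQ : y ∈ Q) :
      x = y := by
    rw [← eval_map_algebraMap] at hx hy
    exact eq_of_isRoot_of_mem (by simpa [Ideal.mem_comap] using h1) hx hy hxQ hyQ
  obtain ⟨α, hα, hαQ⟩ : ∃ α : S, aeval α f = 0 ∧ α ∈ Q := by
    have h := hs.eval_eq_prod_roots_of_monic (hf.map _) 0
    have hm : (f.map (algebraMap R S)).eval 0 ∈ Q := by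
      rw [← coeff_zero_eq_eval_zero, coeff_map]
      exact h0
    rw [h, Ideal.IsPrime.multiset_prod_mem_iff_exists_mem ‹_›] at hm
    obtain ⟨_, hp, hpQ⟩ := hm
    obtain ⟨α, hα, rfl⟩ := Multiset.mem_map.1 hp
    exact ⟨α, by simpa using isRoot_of_mem_roots hα, by simpa using hpQ⟩
  refine ⟨α, hα, uniq (by rw [aeval_algHom_apply, hα, map_zero]) hα (H.le_comap hαQ) hαQ,
    fun β hβ hφ ↦ uniq hβ hα ?_ hαQ⟩
  obtain ⟨a, ha⟩ := H.exists_sub_algebraMap_mem hφ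
  have haQ : algebraMap R S a ∈ Q := by
    refine hroot a ?_
    rw [Ideal.under_def, Ideal.mem_comap, ← eval_map_apply, ← neg_mem_iff]
    have := Q.mem_of_dvd (sub_dvd_eval_sub β (algebraMap R S a) (f.map (algebraMap R S))) ha
    rwa [eval_map_algebraMap, hβ, zero_sub] at this
  simpa using add_mem ha haQ

/-- If `0` is the unique root of `f` modulo `P` and is simple, then some automorphism of a Galois
extension splitting `f` fixes exactly one root of `f`. -/
theorem exists_galois_forall_fixed_root_eq {K L : Type*} [Field K] [NumberField K] [Field L]
    [NumberField L] [Algebra K L] [IsGalois K L] {P : Ideal (𝓞 K)} [P.IsMaximal] {f : (𝓞 K)[X]}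
    (hf : f.Monic) (hs : (f.map (algebraMap (𝓞 K) L)).Splits) (h0 : f.coeff 0 ∈ P)
    (h1 : f.coeff 1 ∉ P) (hroot : ∀ a, f.eval a ∈ P → a ∈ P) :
    ∃ (α : L) (σ : Gal(L/K)), aeval α f = 0 ∧ σ α = α ∧
      ∀ β, aeval β f = 0 → σ β = β → β = α := by
  obtain ⟨Q, _, hQ⟩ := Ideal.exists_maximal_ideal_liesOver_of_isIntegral (S := 𝓞 L) P
  have hlift (x : L) (hx : aeval x f = 0) : ∃ y : 𝓞 L, algebraMap (𝓞 L) L y = x :=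
    ⟨⟨x, isIntegral_trans (R := ℤ) (A := 𝓞 K) x ⟨f, hf, hx⟩⟩, rfl⟩
  obtain ⟨σ, hσ⟩ := IsArithFrobAt.exists_of_isInvariant (𝓞 K) Gal(L/K) Q
  have haeval (y : 𝓞 L) : aeval (algebraMap (𝓞 L) L y) f = 0 ↔ aeval y f = 0 := by
    rw [aeval_algebraMap_apply, map_eq_zero_iff _ (FaithfulSMul.algebraMap_injective (𝓞 L) L)]
  have hs' : (f.map (algebraMap (𝓞 K) (𝓞 L))).Splits := by
    refine Splits.of_splits_map_of_injective (i := algebraMap (𝓞 L) L)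
      (FaithfulSMul.algebraMap_injective (𝓞 L) L) ?_ fun a ha ↦ ?_
    · rwa [Polynomial.map_map, ← IsScalarTower.algebraMap_eq]
    · rw [Polynomial.map_map, ← IsScalarTower.algebraMap_eq] at ha
      exact hlift a (by simpa using isRoot_of_mem_roots ha)
  obtain ⟨α, hα, hσα, h⟩ := exists_root_forall_fixed_root_eq hσ hf hs'
    (hQ.over ▸ h0) (hQ.over ▸ h1) (hQ.over ▸ hroot)
  have hsm (y : 𝓞 L) : σ (algebraMap (𝓞 L) L y) = algebraMap (𝓞 L) L (σ • y) := rfl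
  refine ⟨algebraMap (𝓞 L) L α, σ, (haeval α).2 hα, congrArg (algebraMap (𝓞 L) L) hσα,
    fun β hβ hσβ ↦ ?_⟩
  obtain ⟨y, rfl⟩ := hlift β hβ
  rw [hsm] at hσβ
  exact congrArg _ (h y ((haeval y).1 hβ) (FaithfulSMul.algebraMap_injective (𝓞 L) L hσβ))

theorem Irreducible.aeval_eq_zero_iff_dvd {K E : Type*} [Field K] [Field E] [Algebra K E] {g : K[X]}
    (hg : Irreducible g) {a : E} (ha : aeval a g = 0) (p : K[X]) : aeval a p = 0 ↔ g ∣ p := by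
  rw [← minpoly.dvd_iff, ← minpoly.eq_of_irreducible hg ha,
    IsUnit.mul_right_dvd (by simpa using hg.ne_zero)]

/-- An irreducible polynomial with integral coefficients having `0` as its unique root modulo `P`,
and as a simple one, has singleton root clusters. -/
theorem singleton_cluster_of_residue_root {K : Type*} [Field K] [NumberField K] {P : Ideal (𝓞 K)}
    [P.IsMaximal] {f : (𝓞 K)[X]} (hf : f.Monic) (hirr : Irreducible (f.map (algebraMap (𝓞 K) K)))
    (h0 : f.coeff 0 ∈ P) (h1 : f.coeff 1 ∉ P) (hroot : ∀ a, f.eval a ∈ P → a ∈ P)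
    {E : Type*} [Field E] [Algebra K E] (α : E) (hα : aeval α (f.map (algebraMap (𝓞 K) K)) = 0) :
    {x : E | aeval x (f.map (algebraMap (𝓞 K) K)) = 0 ∧ x ∈ K⟮α⟯} = {α} := by
  set g := f.map (algebraMap (𝓞 K) K) with hg
  let L := g.SplittingField
  have : NumberField L := NumberField.of_module_finite K L
  have : IsGalois K L := IsGalois.of_separable_splitting_field hirr.separable
  have haeval (x : L) : aeval x f = aeval x g := (aeval_map_algebraMap K x f).symm
  obtain ⟨α₀, σ, hα₀, hσ, huniq⟩ := exists_galois_forall_fixed_root_eq (L := L) hf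
    (by simpa [hg, Polynomial.map_map, ← IsScalarTower.algebraMap_eq] using
      SplittingField.splits g) h0 h1 hroot
  rw [haeval] at hα₀
  refine Set.eq_singleton_iff_unique_mem.2 ⟨⟨hα, mem_adjoin_simple_self K α⟩, fun β ⟨hβ, hmem⟩ ↦ ?_⟩
  have hlift : IsIntegral K α := ⟨g, hf.map _, hα⟩
  rw [← mem_toSubalgebra, adjoin_simple_toSubalgebra_of_isAlgebraic hlift.isAlgebraic,
    Algebra.adjoin_singleton_eq_range_aeval] at hmem
  obtain ⟨p, rfl⟩ := hmem
  have hcomp : g ∣ g.comp p := (hirr.aeval_eq_zero_iff_dvd hα _).1 (by rw [aeval_comp]; exact hβ)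
  have hfix : aeval α₀ p = α₀ := by
    refine huniq _ ?_ ?_
    · rw [haeval, ← aeval_comp]
      exact (hirr.aeval_eq_zero_iff_dvd hα₀ _).2 hcomp
    · rw [← AlgEquiv.coe_toAlgHom, ← aeval_algHom_apply, AlgEquiv.coe_toAlgHom, hσ]
  have : g ∣ p - X := (hirr.aeval_eq_zero_iff_dvd hα₀ _).1 (by simp [hfix])
  simpa [sub_eq_zero] using (hirr.aeval_eq_zero_iff_dvd hα _).2 this

theorem exists_isMaximal_ne {K : Type*} [Field K] [NumberField K] :
    ∃ P P' : Ideal (𝓞 K), P.IsMaximal ∧ P'.IsMaximal ∧ P ≠ P' := by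
  have (p : ℕ) (hp : p.Prime) : ∃ P : Ideal (𝓞 K), P.IsMaximal ∧ (p : 𝓞 K) ∈ P := by
    have : (Ideal.span {(p : ℤ)}).IsMaximal :=
      haveI := Fact.mk hp
      Int.ideal_span_isMaximal_of_prime p
    obtain ⟨P, hP, h⟩ := Ideal.exists_maximal_ideal_liesOver_of_isIntegral (S := 𝓞 K)
      (Ideal.span {(p : ℤ)})
    refine ⟨P, hP, ?_⟩
    have : (p : ℤ) ∈ P.under ℤ := h.over ▸ Ideal.mem_span_singleton_self _
    simpa [Ideal.mem_comap] using this
  obtain ⟨P, hP, h2⟩ := this 2 Nat.prime_two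
  obtain ⟨P', hP', h3⟩ := this 3 Nat.prime_three
  refine ⟨P, P', hP, hP', ?_⟩
  rintro rfl
  refine hP.ne_top ((Ideal.eq_top_iff_one P).2 ?_)
  have := P.sub_mem h3 h2
  norm_num at this
  exact this

/-- Proposition 3.1: for a number field `K` and every integer `n ≥ 3` there exists an
irreducible polynomial `f ∈ K[x]` of degree `n` with root cluster size `1`, i.e. for every
root `α` of `f` the only root of `f` lying in `K(α)` is `α` itself. -/
theorem exists_irreducible_with_singleton_clusters
    {K : Type*} [Field K] [NumberField K] (n : ℕ) (hn : 3 ≤ n) :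
    ∃ f : K[X], Irreducible f ∧ f.natDegree = n ∧
      ∀ α : AlgebraicClosure K, aeval α f = 0 →
        {x : AlgebraicClosure K | aeval x f = 0 ∧ x ∈ K⟮α⟯} = {α} := by
  obtain ⟨P, P', hP, hP', hne⟩ := exists_isMaximal_ne (K := K)
  obtain ⟨m, rfl⟩ := Nat.exists_eq_add_of_le' hn
  have hP0 : P ≠ ⊥ := (P.bot_lt_of_maximal (NumberField.RingOfIntegers.not_isField K)).ne'
  obtain ⟨t, ht, ht2⟩ := P.exists_mem_pow_notMem_pow_succ hP0 hP.ne_top 1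
  rw [pow_one] at ht
  have hcop : IsCoprime (P ^ 2) P' := (Ideal.isCoprime_of_isMaximal hne).pow_left
  obtain ⟨e, he, e', he', hee⟩ := Ideal.isCoprime_iff_exists.1 hcop
  have heP : e ∈ P := Ideal.pow_le_self two_ne_zero he
  obtain ⟨c', hc'⟩ := exists_forall_pow_succ_sub_pow_ne (k := 𝓞 K ⧸ P') (m := m + 1) (by simp)
  obtain ⟨c, rfl⟩ := Ideal.Quotient.mk_surjective c'
  let r : (𝓞 K)[X] := C (-e) * X ^ (m + 2) + C (-(e * c)) * X + C (t * e')
  let f : (𝓞 K)[X] := X ^ (m + 3) + r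
  have hr : r.degree < (m + 3 : ℕ) := by
    refine lt_of_le_of_lt (b := ((m + 2 : ℕ) : WithBot ℕ)) ?_ (by norm_cast; omega)
    refine degree_le_of_natDegree_le ?_
    unfold r
    compute_degree
  have hf : f.Monic := monic_X_pow_add hr
  have hdeg : f.natDegree = m + 3 := by
    rw [natDegree_add_eq_left_of_degree_lt (by rwa [degree_X_pow]), natDegree_X_pow]
  have hc0 : f.coeff 0 = t * e' := by simp [f, r]
  have hc1 : f.coeff 1 = -(e * c) := by simp [f, r, coeff_X_pow, coeff_C]
  have hrP : r ∈ P.map C :=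
    add_mem (add_mem (Ideal.mul_mem_right _ _ (Ideal.mem_map_of_mem C (neg_mem heP)))
      (Ideal.mul_mem_right _ _ (Ideal.mem_map_of_mem C (neg_mem (P.mul_mem_right c heP)))))
      (Ideal.mem_map_of_mem C (P.mul_mem_right e' ht))
  have hc : c ∉ P' := fun h ↦ hc' 0 (by simp [(Ideal.Quotient.eq_zero_iff_mem).2 h])
  have heP' : Ideal.Quotient.mk P' e = 1 := by
    rw [← map_one (Ideal.Quotient.mk P'), ← hee, map_add, Ideal.Quotient.eq_zero_iff_mem.2 he',
      add_zero]
  have hEis : f.IsEisensteinAt P := by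
    refine ⟨?_, fun {i} hi ↦ ?_, ?_⟩
    · rw [hf.leadingCoeff]
      exact (Ideal.ne_top_iff_one P).1 hP.ne_top
    · rw [hdeg] at hi
      simpa [f, coeff_X_pow, hi.ne] using Ideal.mem_map_C_iff.1 hrP i
    · rw [hc0]
      intro h
      apply ht2
      have := add_mem (Ideal.mul_mem_left _ t he) h
      rwa [← mul_add, hee, mul_one] at this
  have hirr := (hf.irreducible_iff_irreducible_map_fraction_map (K := K)).1
    (hEis.irreducible hP.isPrime hf.isPrimitive (by omega))
  refine ⟨f.map (algebraMap (𝓞 K) K), hirr, by rw [hf.natDegree_map, hdeg], fun α hα ↦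
    singleton_cluster_of_residue_root (P := P') hf hirr ?_ ?_ ?_ α hα⟩
  · rw [hc0]
    exact P'.mul_mem_left _ he'
  · rw [hc1, neg_mem_iff]
    intro h
    refine hc (Ideal.Quotient.eq_zero_iff_mem.1 ?_)
    simpa [heP'] using Ideal.Quotient.eq_zero_iff_mem.2 h
  · intro a ha
    rw [← Ideal.Quotient.eq_zero_iff_mem] at ha ⊢
    by_contra h0
    apply hc' (Ideal.Quotient.mk P' a)
    apply mul_left_cancel₀ h0
    simp [f, r, heP', Ideal.Quotient.eq_zero_iff_mem.2 he'] at ha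
    linear_combination ha
end
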